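/- arXiv:2111.09379 — 3 statements merged into one kernel-verified Lean document; each statement's English description precedes it below -/
import Mathlib

section
/- Consider the triangle with side lengths a = 2^{−n} − 2^{−5n}, b = 2^{−5n}, c = 2^{−n} − 2^{−30n} for n large. Then the altitude m_b of this triangle perpendicular to the side of length b satisfies m_b ≥ C·2^{−13.5n} for some absolute constant C > 0 independent of n. -/
open Real

/-- For the triangle with sides `a = 2^{-n} - 2^{-5n}`, `b = 2^{-5n}`,
`c = 2^{-n} - 2^{-30n}`, the altitude `m_b = 2·Area/b` perpendicular to the side
`b` (Area given by Heron's formula) is at least `C · 2^{-13.5 n}` for an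
absolute constant `C > 0`, for all sufficiently large `n`. -/
theorem stmt9 :
    ∃ C > (0 : ℝ), ∃ N : ℕ, ∀ n : ℕ, N ≤ n →
      C * (2 : ℝ) ^ (-(13.5 : ℝ) * (n : ℝ)) ≤
        (let a : ℝ := (2 : ℝ) ^ (-(n : ℝ)) - (2 : ℝ) ^ (-5 * (n : ℝ));
         let b : ℝ := (2 : ℝ) ^ (-5 * (n : ℝ));
         let c : ℝ := (2 : ℝ) ^ (-(n : ℝ)) - (2 : ℝ) ^ (-30 * (n : ℝ));
         let s : ℝ := (a + b + c) / 2;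
         let area : ℝ := Real.sqrt (s * (s - a) * (s - b) * (s - c));
         2 * area / b) := by
  refine ⟨1 / 2, by norm_num, 1, fun n hn => ?_⟩
  have h2 : (0 : ℝ) < 2 := by norm_num
  obtain ⟨x, hx⟩ : ∃ x : ℝ, x = (2 : ℝ) ^ (-(n : ℝ)) := ⟨_, rfl⟩
  obtain ⟨y, hy⟩ : ∃ y : ℝ, y = (2 : ℝ) ^ (-(13.5 : ℝ) * (n : ℝ)) := ⟨_, rfl⟩
  have h5 : (2 : ℝ) ^ (-5 * (n : ℝ)) = x ^ 5 := by
    rw [hx, ← Real.rpow_mul_natCast h2.le]; congr 1; push_cast; ring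
  have h30 : (2 : ℝ) ^ (-30 * (n : ℝ)) = x ^ 30 := by
    rw [hx, ← Real.rpow_mul_natCast h2.le]; congr 1; push_cast; ring
  have hy2 : y ^ 2 = x ^ 27 := by
    rw [hx, hy, ← Real.rpow_mul_natCast h2.le, ← Real.rpow_mul_natCast h2.le]
    congr 1; push_cast; ring
  have hx0 : 0 < x := by rw [hx]; positivity
  have hxh : x ≤ 1 / 2 := by
    have hn' : (1 : ℝ) ≤ n := by exact_mod_cast hn
    have : (2 : ℝ) ^ (-(n : ℝ)) ≤ (2 : ℝ) ^ (-1 : ℝ) :=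
      Real.rpow_le_rpow_of_exponent_le (by norm_num) (by linarith)
    rw [Real.rpow_neg_one] at this
    rw [hx]; linarith
  simp only [h5, h30, ← hx, ← hy]
  have hx5 : 0 < x ^ 5 := by positivity
  have hx30 : 0 < x ^ 30 := by positivity
  have e5 : x ^ 5 ≤ x / 4 := by
    have h4 : x ^ 4 ≤ (1 / 2) ^ 4 := pow_le_pow_left₀ hx0.le hxh 4
    have : x ^ 5 = x * x ^ 4 := by ring
    rw [this]; nlinarith
  have e30 : x ^ 30 ≤ x ^ 5 := pow_le_pow_of_le_one hx0.le (by linarith) (by norm_num)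
  rw [le_div_iff₀ hx5]
  have key : y * x ^ 5 / 4 ≤ Real.sqrt
      ((x - x ^ 30 / 2) * (x ^ 5 - x ^ 30 / 2) * (x - x ^ 5 - x ^ 30 / 2) * (x ^ 30 / 2)) := by
    apply Real.le_sqrt_of_sq_le
    have e : (y * x ^ 5 / 4) ^ 2 = (x / 2) * (x ^ 5 / 2) * (x / 2) * (x ^ 30 / 2) := by
      have : (y * x ^ 5 / 4) ^ 2 = y ^ 2 * x ^ 10 / 16 := by ring
      rw [this, hy2]; ring
    rw [e]
    have a1 : x / 2 ≤ x - x ^ 30 / 2 := by linarith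
    have a2 : x ^ 5 / 2 ≤ x ^ 5 - x ^ 30 / 2 := by linarith
    have a3 : x / 2 ≤ x - x ^ 5 - x ^ 30 / 2 := by linarith
    have p1 : 0 ≤ x - x ^ 30 / 2 := by linarith
    have p2 : 0 ≤ x ^ 5 - x ^ 30 / 2 := by linarith
    gcongr
  have conv : ∀ u v : ℝ, ((x - u + u + (x - v)) / 2) * ((x - u + u + (x - v)) / 2 - (x - u)) *
      ((x - u + u + (x - v)) / 2 - u) * ((x - u + u + (x - v)) / 2 - (x - v)) =
      (x - v / 2) * (u - v / 2) * (x - u - v / 2) * (v / 2) := by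
    intro u v; ring
  rw [conv]
  linarith
end

section
/- Let χ(x) = 1_{[r−r^δ, r]}(|x|) be the indicator of the annulus {x ∈ ℝ² : r − r^δ ≤ |x| ≤ r}, with 0 < r < 1 and δ ≥ 1. Then the Fourier transform of χ satisfies |χ̂(ξ)| ≤ C · r^{1/2} · |ξ|^{−1/2} · min(r^δ, |ξ|^{−1}) for all ξ ≠ 0, with an absolute constant C. -/
open MeasureTheory Metric Set Filter Real
open scoped RealInnerProductSpace

/-- The Fourier transform of a (bounded, compactly supported) function on the
Euclidean plane: `f̂(ξ) = ∫ e^{-2πi⟨x,ξ⟩} f(x) dx`. -/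
noncomputable def ft (f : EuclideanSpace ℝ (Fin 2) → ℂ)
    (ξ : EuclideanSpace ℝ (Fin 2)) : ℂ :=
  ∫ x : EuclideanSpace ℝ (Fin 2),
    Complex.exp (-2 * Real.pi * Complex.I * (⟪x, ξ⟫ : ℝ)) * f x

/-- Indicator of the annulus `{x : r - r^δ ≤ |x| ≤ r}` in the plane. -/
noncomputable def annInd (r δ : ℝ) : EuclideanSpace ℝ (Fin 2) → ℂ :=
  Set.indicator {x : EuclideanSpace ℝ (Fin 2) | r - r ^ δ ≤ ‖x‖ ∧ ‖x‖ ≤ r}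
    (fun _ => (1 : ℂ))

/-- exponential phase -/
noncomputable def ph (t θ : ℝ) : ℂ := Complex.exp (-(Complex.I * (t * Real.cos θ : ℝ)))

lemma ph_norm (t θ : ℝ) : ‖ph t θ‖ = 1 := by
  rw [ph, Complex.norm_exp]; simp

lemma ph_cont : Continuous (fun p : ℝ × ℝ => ph p.1 p.2) := by
  unfold ph; fun_prop

lemma ph_cont_right (t : ℝ) : Continuous (fun θ : ℝ => ph t θ) := by
  unfold ph; fun_prop

lemma ph_deriv_right (t θ : ℝ) :
    HasDerivAt (fun θ : ℝ => ph t θ) (Complex.I * t * Real.sin θ * ph t θ) θ := by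
  unfold ph
  have h : HasDerivAt (fun θ : ℝ => ((t * Real.cos θ : ℝ) : ℂ)) ((t * (-Real.sin θ) : ℝ) : ℂ) θ :=
    HasDerivAt.ofReal_comp ((Real.hasDerivAt_cos θ).const_mul t)
  refine (h.const_mul Complex.I).fun_neg.cexp.congr_deriv ?_
  push_cast; ring

lemma ph_deriv_left (t θ : ℝ) :
    HasDerivAt (fun t : ℝ => ph t θ) (-Complex.I * Real.cos θ * ph t θ) t := by
  unfold ph
  have h : HasDerivAt (fun t : ℝ => ((t * Real.cos θ : ℝ) : ℂ)) ((1 * Real.cos θ : ℝ) : ℂ) t :=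
    HasDerivAt.ofReal_comp ((hasDerivAt_id t).mul_const _)
  refine (h.const_mul Complex.I).fun_neg.cexp.congr_deriv ?_
  push_cast; ring

/-- middle part of van der Corput -/
lemma vdc_mid (ψ ψ' : ℝ → ℝ) (hψ : ∀ x, HasDerivAt ψ (ψ' x) x) (hc : Continuous ψ')
    (h1 : ∀ x, |ψ x| ≤ 1) (h2 : ∀ x, |ψ' x| ≤ 1) (t ε : ℝ) (ht : 0 < t) (hε : 0 < ε)
    (hε1 : ε ≤ 1) :
    ‖∫ θ in ε..(π - ε), (ψ θ : ℂ) * ph t θ‖ ≤ 10 / (t * ε) := by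
  have hpi := Real.pi_gt_three
  have hle : ε ≤ π - ε := by linarith
  have hs : ∀ x ∈ Set.uIcc ε (π - ε), 0 < Real.sin x := by
    intro x hx
    rw [Set.uIcc_of_le hle] at hx
    exact Real.sin_pos_of_pos_of_lt_pi (by linarith [hx.1]) (by linarith [hx.2])
  have hse : 0 < Real.sin ε := Real.sin_pos_of_pos_of_lt_pi hε (by linarith)
  have hcψ : Continuous ψ := continuous_iff_continuousAt.2 fun x => (hψ x).continuousAt
  have hcph := ph_cont_right t
  set v : ℝ → ℂ := fun θ => ((ψ' θ / Real.sin θ - ψ θ * Real.cos θ / Real.sin θ ^ 2 : ℝ) : ℂ) * ph t θ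
    with hv
  have hvc : ContinuousOn v (Set.uIcc ε (π - ε)) := by
    refine ContinuousOn.mul ?_ hcph.continuousOn
    refine Complex.continuous_ofReal.comp_continuousOn ?_
    refine ContinuousOn.sub ?_ ?_
    · exact hc.continuousOn.div Real.continuous_sin.continuousOn fun x hx => (hs x hx).ne'
    · exact (hcψ.mul Real.continuous_cos).continuousOn.div
        (Real.continuous_sin.pow 2).continuousOn fun x hx => (pow_pos (hs x hx) 2).ne'
  have hwc : Continuous (fun θ => (ψ θ : ℂ) * ph t θ) := by fun_prop
  have hd : ∀ x ∈ Set.uIcc ε (π - ε), HasDerivAt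
      (fun θ => ((ψ θ / Real.sin θ : ℝ) : ℂ) * ph t θ)
      (v x + Complex.I * t * ((ψ x : ℂ) * ph t x)) x := by
    intro x hx
    have hsx := (hs x hx).ne'
    have hsx' : (Real.sin x : ℂ) ≠ 0 := by exact_mod_cast hsx
    have a := HasDerivAt.ofReal_comp ((hψ x).fun_div (Real.hasDerivAt_sin x) hsx)
    refine (a.fun_mul (ph_deriv_right t x)).congr_deriv ?_
    simp only [hv]
    push_cast at hsx' ⊢
    field_simp
    try ring
  have hI := intervalIntegral.integral_eq_sub_of_hasDerivAt hd
    (hvc.intervalIntegrable.add ((hwc.intervalIntegrable _ _).const_mul _))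
  rw [intervalIntegral.integral_add hvc.intervalIntegrable
    ((hwc.intervalIntegrable _ _).const_mul _), intervalIntegral.integral_const_mul] at hI
  -- bound on v
  have hcot : ∀ x ∈ Set.uIcc ε (π - ε), HasDerivAt (fun θ => -2 * (Real.cos θ / Real.sin θ))
      (2 / Real.sin x ^ 2) x := by
    intro x hx
    have hsx := (hs x hx).ne'
    refine (((Real.hasDerivAt_cos x).fun_div (Real.hasDerivAt_sin x) hsx).const_mul (-2)).congr_deriv ?_
    field_simp
    linarith [Real.sin_sq_add_cos_sq x]
  have hgi : IntervalIntegrable (fun x => 2 / Real.sin x ^ 2) volume ε (π - ε) :=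
    (continuousOn_const.div (Real.continuous_sin.pow 2).continuousOn
      fun x hx => (pow_pos (hs x hx) 2).ne').intervalIntegrable
  have hJ := intervalIntegral.integral_eq_sub_of_hasDerivAt hcot hgi
  have hV : ‖∫ x in ε..(π - ε), v x‖ ≤ ∫ x in ε..(π - ε), 2 / Real.sin x ^ 2 := by
    refine intervalIntegral.norm_integral_le_of_norm_le hle ?_ hgi
    refine Filter.Eventually.of_forall fun x hx => ?_
    have hsx := hs x (by rw [Set.uIcc_of_le hle]; exact ⟨hx.1.le, hx.2⟩)
    rw [hv]
    simp only [norm_mul, ph_norm, mul_one, Complex.norm_real, Real.norm_eq_abs]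
    have e : ψ' x / Real.sin x - ψ x * Real.cos x / Real.sin x ^ 2
        = (ψ' x * Real.sin x - ψ x * Real.cos x) / Real.sin x ^ 2 := by field_simp
    rw [e, abs_div, abs_of_pos (pow_pos hsx 2)]
    refine div_le_div_of_nonneg_right ?_ (pow_pos hsx 2).le
    refine (abs_sub _ _).trans ?_
    rw [abs_mul, abs_mul]
    have := mul_le_mul (h2 x) (Real.abs_sin_le_one x) (abs_nonneg _) zero_le_one
    have := mul_le_mul (h1 x) (Real.abs_cos_le_one x) (abs_nonneg _) zero_le_one
    linarith
  rw [hJ, Real.cos_pi_sub, Real.sin_pi_sub] at hV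
  have hV' : ‖∫ x in ε..(π - ε), v x‖ ≤ 4 / Real.sin ε := by
    refine hV.trans ?_
    have : -2 * (-Real.cos ε / Real.sin ε) - -2 * (Real.cos ε / Real.sin ε)
       = 4 * Real.cos ε / Real.sin ε := by ring
    rw [this]
    exact div_le_div_of_nonneg_right (by linarith [Real.cos_le_one ε]) hse.le
  have hB : ∀ x, Real.sin x = Real.sin ε →
      ‖((ψ x / Real.sin x : ℝ) : ℂ) * ph t x‖ ≤ 1 / Real.sin ε := by
    intro x hx
    rw [norm_mul, ph_norm, mul_one, Complex.norm_real, Real.norm_eq_abs, hx, abs_div,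
      abs_of_pos hse]
    exact div_le_div_of_nonneg_right (h1 x) hse.le
  have hB1 := hB ε rfl
  have hB2 := hB (π - ε) (Real.sin_pi_sub ε)
  have hfin : t * ‖∫ θ in ε..(π - ε), (ψ θ : ℂ) * ph t θ‖ ≤ 6 / Real.sin ε := by
    have e : t * ‖∫ θ in ε..(π - ε), (ψ θ : ℂ) * ph t θ‖
        = ‖Complex.I * t * ∫ θ in ε..(π - ε), (ψ θ : ℂ) * ph t θ‖ := by
      rw [norm_mul, norm_mul, Complex.norm_I, Complex.norm_real, Real.norm_eq_abs, abs_of_pos ht,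
        one_mul]
    rw [e, eq_sub_of_add_eq' hI]
    refine (norm_sub_le _ _).trans ?_
    have := norm_sub_le (((ψ (π - ε) / Real.sin (π - ε) : ℝ) : ℂ) * ph t (π - ε))
      (((ψ ε / Real.sin ε : ℝ) : ℂ) * ph t ε)
    have e6 : 6 / Real.sin ε = 1 / Real.sin ε + 1 / Real.sin ε + 4 / Real.sin ε := by ring
    linarith
  have hsl : 2 / π * ε ≤ Real.sin ε := Real.mul_le_sin hε.le (by linarith)
  have hsl' : 6 / 10 * ε ≤ Real.sin ε := by
    refine le_trans ?_ hsl
    refine mul_le_mul_of_nonneg_right ?_ hε.le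
    rw [le_div_iff₀ Real.pi_pos]
    linarith [Real.pi_lt_d2]
  rw [le_div_iff₀ (by positivity)]
  rw [le_div_iff₀ hse] at hfin
  have := mul_le_mul_of_nonneg_left hsl' (by positivity : 0 ≤ t * ‖∫ θ in ε..(π - ε), (ψ θ : ℂ) * ph t θ‖)
  linarith

lemma vdc_half (ψ ψ' : ℝ → ℝ) (hψ : ∀ x, HasDerivAt ψ (ψ' x) x) (hc : Continuous ψ')
    (h1 : ∀ x, |ψ x| ≤ 1) (h2 : ∀ x, |ψ' x| ≤ 1) (t : ℝ) (ht : 0 < t) :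
    ‖∫ θ in (0 : ℝ)..π, (ψ θ : ℂ) * ph t θ‖ ≤ 12 / √t := by
  have hcψ : Continuous ψ := continuous_iff_continuousAt.2 fun x => (hψ x).continuousAt
  have hcph := ph_cont_right t
  have hwc : Continuous (fun θ => (ψ θ : ℂ) * ph t θ) := by fun_prop
  have hn : ∀ a b : ℝ, ‖∫ θ in a..b, (ψ θ : ℂ) * ph t θ‖ ≤ 1 * |b - a| := by
    intro a b
    refine intervalIntegral.norm_integral_le_of_norm_le_const fun x _ => ?_
    rw [norm_mul, ph_norm, mul_one, Complex.norm_real]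
    exact h1 x
  have hst : 0 < √t := Real.sqrt_pos.2 ht
  rcases le_or_gt t 1 with h | h
  · refine (hn _ _).trans ?_
    have : √t ≤ 1 := Real.sqrt_le_one.2 h
    rw [one_mul, sub_zero, abs_of_pos Real.pi_pos, le_div_iff₀ hst]
    nlinarith [Real.pi_lt_d2, Real.pi_pos]
  · have hone : 1 ≤ √t := Real.one_le_sqrt.2 h.le
    set ε := 1 / √t with hε
    have hε0 : 0 < ε := by positivity
    have hε1 : ε ≤ 1 := by rw [hε, div_le_one hst]; exact hone
    have hm := vdc_mid ψ ψ' hψ hc h1 h2 t ε ht hε0 hε1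
    have ii := fun a b => hwc.intervalIntegrable (μ := volume) a b
    rw [← intervalIntegral.integral_add_adjacent_intervals (ii 0 ε) (ii ε π),
      ← intervalIntegral.integral_add_adjacent_intervals (ii ε (π - ε)) (ii (π - ε) π)]
    have a1 := hn 0 ε
    have a2 := hn (π - ε) π
    rw [one_mul, sub_zero, abs_of_pos hε0] at a1
    rw [one_mul, sub_sub_cancel, abs_of_pos hε0] at a2
    have e : 10 / (t * ε) = 10 * ε := by
      have : t * ε = √t := by
        rw [hε, mul_one_div, Real.div_sqrt]
      rw [this, hε]; ring
    rw [e] at hm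
    have e2 : 12 / √t = 12 * ε := by rw [hε]; ring
    rw [e2]
    refine (norm_add_le _ _).trans ?_
    have := norm_add_le (∫ θ in ε..(π - ε), (ψ θ : ℂ) * ph t θ) (∫ θ in (π - ε)..π, (ψ θ : ℂ) * ph t θ)
    linarith

lemma vdc_full (ψ ψ' : ℝ → ℝ) (hψ : ∀ x, HasDerivAt ψ (ψ' x) x) (hc : Continuous ψ')
    (h1 : ∀ x, |ψ x| ≤ 1) (h2 : ∀ x, |ψ' x| ≤ 1) (hev : ∀ x, ψ (-x) = ψ x) (t : ℝ) (ht : 0 < t) :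
    ‖∫ θ in (-π)..π, (ψ θ : ℂ) * ph t θ‖ ≤ 24 / √t := by
  have hcψ : Continuous ψ := continuous_iff_continuousAt.2 fun x => (hψ x).continuousAt
  have hcph := ph_cont_right t
  have hwc : Continuous (fun θ => (ψ θ : ℂ) * ph t θ) := by fun_prop
  have hh := vdc_half ψ ψ' hψ hc h1 h2 t ht
  have ii := fun a b => hwc.intervalIntegrable (μ := volume) a b
  rw [← intervalIntegral.integral_add_adjacent_intervals (ii (-π) 0) (ii 0 π)]
  have e : (∫ θ in (-π)..0, (ψ θ : ℂ) * ph t θ) = ∫ θ in (0 : ℝ)..π, (ψ θ : ℂ) * ph t θ := by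
    have := intervalIntegral.integral_comp_neg (a := 0) (b := π) (fun θ => (ψ θ : ℂ) * ph t θ)
    rw [neg_zero] at this
    rw [← this]
    simp [hev, ph]
  rw [e]
  refine (norm_add_le _ _).trans ?_
  have : 24 / √t = 12 / √t + 12 / √t := by ring
  linarith

/-- Bessel-type integral of order zero -/
noncomputable def FF (t : ℝ) : ℂ := ∫ θ in (-π)..π, ph t θ

/-- Bessel-type integral of order one -/
noncomputable def GG (t : ℝ) : ℂ := ∫ θ in (-π)..π, (Real.cos θ : ℂ) * ph t θ

lemma FF_bound (t : ℝ) (ht : 0 < t) : ‖FF t‖ ≤ 24 / √t := by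
  have := vdc_full (fun _ => 1) (fun _ => 0) (fun x => hasDerivAt_const x 1) continuous_const
    (by simp) (by simp) (by simp) t ht
  simpa [FF] using this

lemma GG_bound (t : ℝ) (ht : 0 < t) : ‖GG t‖ ≤ 24 / √t := by
  have := vdc_full Real.cos (fun x => -Real.sin x) Real.hasDerivAt_cos
    (Real.continuous_sin.neg)
    Real.abs_cos_le_one (by simpa using Real.abs_sin_le_one) (by simp) t ht
  simpa only [GG] using this

lemma FF_cont : Continuous FF := by
  unfold FF
  exact intervalIntegral.continuous_parametric_intervalIntegral_of_continuous' ph_cont _ _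

lemma GG_parts (t : ℝ) : GG t = -Complex.I * t * ∫ θ in (-π)..π, (Real.sin θ : ℂ) ^ 2 * ph t θ := by
  have hcph := ph_cont_right t
  have c1 : Continuous fun θ : ℝ => (Real.cos θ : ℂ) * ph t θ := by fun_prop
  have c2 : Continuous fun θ : ℝ => (Real.sin θ : ℂ) ^ 2 * ph t θ := by fun_prop
  have hd : ∀ x ∈ Set.uIcc (-π) π, HasDerivAt (fun θ : ℝ => (Real.sin θ : ℂ) * ph t θ)
      ((Real.cos x : ℂ) * ph t x + Complex.I * t * ((Real.sin x : ℂ) ^ 2 * ph t x)) x := by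
    intro x _
    refine ((HasDerivAt.ofReal_comp (Real.hasDerivAt_sin x)).fun_mul (ph_deriv_right t x)).congr_deriv ?_
    ring
  have := intervalIntegral.integral_eq_sub_of_hasDerivAt hd
    ((c1.add (c2.const_mul _)).intervalIntegrable _ _)
  rw [intervalIntegral.integral_add (c1.intervalIntegrable _ _)
    ((c2.intervalIntegrable _ _).const_mul _), intervalIntegral.integral_const_mul] at this
  simp only [Real.sin_pi, Real.sin_neg, neg_zero, Complex.ofReal_zero, zero_mul, sub_zero] at this
  rw [GG, eq_neg_of_add_eq_zero_left this]; ring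

lemma GG_deriv (t : ℝ) : HasDerivAt GG
    (∫ θ in (-π)..π, -Complex.I * ((Real.cos θ : ℂ) ^ 2 * ph t θ)) t := by
  have hm : ∀ t, Continuous (ph t) := ph_cont_right
  refine (intervalIntegral.hasDerivAt_integral_of_dominated_loc_of_deriv_le (μ := volume)
    (F := fun t θ => (Real.cos θ : ℂ) * ph t θ) (bound := fun _ => 1)
    (F' := fun t θ => -Complex.I * ((Real.cos θ : ℂ) ^ 2 * ph t θ)) (s := Set.univ) Filter.univ_mem
    ?_ ?_ ?_ ?_ ?_ ?_).2
  · refine Filter.Eventually.of_forall fun t => Continuous.aestronglyMeasurable ?_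
    have := hm t; fun_prop
  · refine Continuous.intervalIntegrable ?_ _ _
    have := hm t; fun_prop
  · refine Continuous.aestronglyMeasurable ?_
    have := hm t; fun_prop
  · refine Filter.Eventually.of_forall fun θ _ t _ => ?_
    simp only [norm_mul, norm_neg, Complex.norm_I, ph_norm, norm_pow, Complex.norm_real,
      Real.norm_eq_abs, one_mul, mul_one]
    exact pow_le_one₀ (abs_nonneg _) (Real.abs_cos_le_one θ)
  · exact intervalIntegrable_const
  · refine Filter.Eventually.of_forall fun θ _ t _ => ?_
    refine ((ph_deriv_left t θ).const_mul (Real.cos θ : ℂ)).congr_deriv ?_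
    ring

lemma tGG_deriv (t : ℝ) : HasDerivAt (fun t : ℝ => (t : ℂ) * GG t) (-Complex.I * t * FF t) t := by
  have h1 : HasDerivAt (fun t : ℝ => (t : ℂ)) ((1 : ℝ) : ℂ) t := HasDerivAt.ofReal_comp (hasDerivAt_id t)
  refine (h1.fun_mul (GG_deriv t)).congr_deriv ?_
  have hcph := ph_cont_right t
  have c1 : Continuous fun θ : ℝ => (Real.cos θ : ℂ) ^ 2 * ph t θ := by fun_prop
  have c2 : Continuous fun θ : ℝ => (Real.sin θ : ℂ) ^ 2 * ph t θ := by fun_prop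
  have e : FF t = (∫ θ in (-π)..π, (Real.sin θ : ℂ) ^ 2 * ph t θ)
      + ∫ θ in (-π)..π, (Real.cos θ : ℂ) ^ 2 * ph t θ := by
    rw [← intervalIntegral.integral_add (c2.intervalIntegrable _ _) (c1.intervalIntegrable _ _), FF]
    congr 1; ext θ
    rw [← add_mul]
    have : (Real.sin θ : ℂ) ^ 2 + (Real.cos θ : ℂ) ^ 2 = 1 := by
      exact_mod_cast Real.sin_sq_add_cos_sq θ
    rw [this, one_mul]
  rw [intervalIntegral.integral_const_mul, GG_parts, e]
  push_cast; ring

lemma sqrt_aux (k s r : ℝ) (hk : 0 < k) (hs : 0 < s) (hsr : s ≤ r) (z : ℂ)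
    (hz : ‖z‖ ≤ 24 / √(k * s)) : ‖(s : ℂ) * z‖ ≤ 24 * √r / √k := by
  rw [norm_mul, Complex.norm_real, Real.norm_eq_abs, abs_of_pos hs]
  refine (mul_le_mul_of_nonneg_left hz hs.le).trans ?_
  have hss : 0 < √s := Real.sqrt_pos.2 hs
  have hkk : 0 < √k := Real.sqrt_pos.2 hk
  have : s * (24 / √(k * s)) = 24 * √s / √k := by
    rw [Real.sqrt_mul hk.le]
    nth_rewrite 1 [← Real.mul_self_sqrt hs.le]
    field_simp
  rw [this]
  gcongr

lemma radial_bound (k a r : ℝ) (hk : 0 < k) (ha : 0 ≤ a) (har : a ≤ r) :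
    ‖∫ s in a..r, (s : ℂ) * FF (k * s)‖ ≤ 48 * √r / √k * min (r - a) k⁻¹ := by
  have hC : 0 ≤ 24 * √r / √k := by positivity
  have h1 : ‖∫ s in a..r, (s : ℂ) * FF (k * s)‖ ≤ 24 * √r / √k * |r - a| := by
    refine intervalIntegral.norm_integral_le_of_norm_le_const fun s hs => ?_
    rw [Set.uIoc_of_le har] at hs
    have hs0 : 0 < s := lt_of_le_of_lt ha hs.1
    exact sqrt_aux k s r hk hs0 hs.2 _ (FF_bound _ (by positivity))
  rw [abs_of_nonneg (by linarith)] at h1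
  have hG : ∀ s, 0 ≤ s → s ≤ r → ‖(s : ℂ) * GG (k * s)‖ ≤ 24 * √r / √k := by
    intro s hs hsr
    rcases hs.eq_or_lt with h | h
    · rw [← h]; simpa using hC
    · exact sqrt_aux k s r hk h hsr _ (GG_bound _ (by positivity))
  have hk' : (k : ℂ) ≠ 0 := by exact_mod_cast hk.ne'
  have hd : ∀ s ∈ Set.uIcc a r, HasDerivAt (fun s : ℝ => Complex.I * (k : ℂ)⁻¹ * ((s : ℂ) * GG (k * s)))
      ((s : ℂ) * FF (k * s)) s := by
    intro s _
    have h := (tGG_deriv (k * s)).scomp s ((hasDerivAt_id s).const_mul k)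
    have h' := h.const_mul (Complex.I * (k : ℂ)⁻¹ * (k : ℂ)⁻¹)
    have e : (fun s : ℝ => Complex.I * (k : ℂ)⁻¹ * ((s : ℂ) * GG (k * s))) = fun y =>
        Complex.I * (k : ℂ)⁻¹ * (k : ℂ)⁻¹ * ((fun t : ℝ => (t : ℂ) * GG t) ∘ HMul.hMul k) y := by
      ext x
      simp only [Function.comp]
      push_cast; field_simp
    rw [e]
    refine h'.congr_deriv ?_
    · simp only [id, mul_one, Complex.real_smul]
      push_cast
      field_simp
      rw [Complex.I_sq]; ring
  have hc : Continuous fun s : ℝ => (s : ℂ) * FF (k * s) := by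
    have := FF_cont; fun_prop
  have hI := intervalIntegral.integral_eq_sub_of_hasDerivAt hd (hc.intervalIntegrable _ _)
  have h2 : ‖∫ s in a..r, (s : ℂ) * FF (k * s)‖ ≤ 48 * √r / √k * k⁻¹ := by
    rw [hI, ← mul_sub, norm_mul, norm_mul, Complex.norm_I, norm_inv, Complex.norm_real,
      Real.norm_eq_abs, abs_of_pos hk, one_mul, mul_comm]
    refine mul_le_mul_of_nonneg_right ?_ (by positivity)
    have := norm_sub_le ((r : ℂ) * GG (k * r)) ((a : ℂ) * GG (k * a))
    have := hG r (ha.trans har) le_rfl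
    have := hG a ha har
    have : 48 * √r / √k = 24 * √r / √k + 24 * √r / √k := by ring
    linarith
  rcases min_choice (r - a) k⁻¹ with h | h <;> rw [h]
  · have : 48 * √r / √k = 24 * √r / √k + 24 * √r / √k := by ring
    have := mul_nonneg hC (by linarith : 0 ≤ r - a)
    nlinarith
  · exact h2

lemma ph_shift (t φ : ℝ) : ∫ θ in (-π)..π, ph t (θ - φ) = FF t := by
  rw [intervalIntegral.integral_comp_sub_right (fun θ => ph t θ) φ, FF]
  have hp : Function.Periodic (ph t) (2 * π) := by
    intro x; simp [ph, Real.cos_add_two_pi]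
  have := hp.intervalIntegral_add_eq (-π - φ) (-π)
  have e1 : -π - φ + 2 * π = π - φ := by ring
  have e2 : -π + 2 * π = π := by ring
  rwa [e1, e2] at this

lemma inner_polar (s θ : ℝ) (w : ℂ) :
    (inner ℝ (Complex.polarCoord.symm (s, θ)) w : ℝ) = s * ‖w‖ * Real.cos (θ - w.arg) := by
  rw [Complex.polarCoord_symm_apply, Complex.inner]
  have h1 := Complex.norm_mul_cos_arg w
  have h2 := Complex.norm_mul_sin_arg w
  simp only [Complex.mul_re, Complex.conj_re, Complex.conj_im, map_mul, map_add, Complex.add_re,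
    Complex.add_im, Complex.mul_im, Complex.conj_ofReal, Complex.conj_I, Complex.ofReal_re,
    Complex.ofReal_im, Complex.neg_re, Complex.neg_im, Complex.I_re, Complex.I_im]
  rw [Real.cos_sub, ← h1, ← h2]
  ring

lemma ft_eq (r δ : ℝ) (ha : 0 ≤ r - r ^ δ) (har : r - r ^ δ ≤ r)
    (ξ : EuclideanSpace ℝ (Fin 2)) :
    ft (annInd r δ) ξ = ∫ s in (r - r ^ δ)..r, (s : ℂ) * FF (2 * π * ‖ξ‖ * s) := by
  set U := Complex.orthonormalBasisOneI.repr with hU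
  set w := U.symm ξ with hw
  set a := r - r ^ δ with haa
  have hwn : ‖w‖ = ‖ξ‖ := U.symm.norm_map ξ
  unfold ft
  rw [← (U.measurePreserving).integral_comp U.toHomeomorph.measurableEmbedding,
    ← Complex.integral_comp_polarCoord_symm, polarCoord_target]
  have key : ∀ p ∈ Set.Ioi (0 : ℝ) ×ˢ Set.Ioo (-π) π,
      p.1 • (Complex.exp (-2 * π * Complex.I *
        ((inner ℝ (U (Complex.polarCoord.symm p)) ξ : ℝ) : ℂ)) * annInd r δ (U (Complex.polarCoord.symm p)))
      = (Set.Icc a r ×ˢ (Set.univ : Set ℝ)).indicator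
        (fun p : ℝ × ℝ => (p.1 : ℂ) * ph (2 * π * ‖ξ‖ * p.1) (p.2 - w.arg)) p := by
    rintro ⟨s, θ⟩ ⟨hs, hθ⟩
    have hs : 0 < s := hs
    have hn : ‖U (Complex.polarCoord.symm (s, θ))‖ = s := by
      rw [U.norm_map, Complex.norm_polarCoord_symm, abs_of_pos hs]
    have hi : (inner ℝ (U (Complex.polarCoord.symm (s, θ))) ξ : ℝ)
        = s * ‖ξ‖ * Real.cos (θ - w.arg) := by
      rw [← hwn, ← inner_polar, ← U.inner_map_map, hw, U.apply_symm_apply]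
    rw [hi]
    unfold annInd
    by_cases h : a ≤ s ∧ s ≤ r
    · rw [Set.indicator_of_mem (by simpa only [Set.mem_setOf_eq, hn] using h),
        Set.indicator_of_mem (by simpa using h)]
      rw [Complex.real_smul, mul_one, ph]
      congr 2
      push_cast; ring
    · rw [Set.indicator_of_notMem (by simpa only [Set.mem_setOf_eq, hn] using h),
        Set.indicator_of_notMem (by simpa using h)]
      simp
  rw [setIntegral_congr_fun (measurableSet_Ioi.prod measurableSet_Ioo) key,
    setIntegral_indicator (measurableSet_Icc.prod MeasurableSet.univ), Set.prod_inter_prod,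
    Set.inter_univ]
  have hc : Continuous (fun p : ℝ × ℝ => (p.1 : ℂ) * ph (2 * π * ‖ξ‖ * p.1) (p.2 - w.arg)) := by
    unfold ph; fun_prop
  have hintg : IntegrableOn (fun p : ℝ × ℝ => (p.1 : ℂ) * ph (2 * π * ‖ξ‖ * p.1) (p.2 - w.arg))
      ((Set.Ioi 0 ∩ Set.Icc a r) ×ˢ Set.Ioo (-π) π) (volume.prod volume) := by
    refine (hc.continuousOn.integrableOn_compact
      (isCompact_Icc.prod isCompact_Icc : IsCompact (Set.Icc a r ×ˢ Set.Icc (-π) π))).mono_set ?_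
    exact Set.prod_mono Set.inter_subset_right Set.Ioo_subset_Icc_self
  rw [Measure.volume_eq_prod, setIntegral_prod _ hintg]
  have hin : ∀ s : ℝ, (∫ θ in Set.Ioo (-π) π, (s : ℂ) * ph (2 * π * ‖ξ‖ * s) (θ - w.arg))
      = (s : ℂ) * FF (2 * π * ‖ξ‖ * s) := by
    intro s
    rw [← ph_shift _ w.arg, ← integral_Ioc_eq_integral_Ioo,
      ← intervalIntegral.integral_of_le (by linarith [Real.pi_pos]),
      intervalIntegral.integral_const_mul]
  simp only [hin]
  rw [intervalIntegral.integral_of_le har]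
  rcases ha.eq_or_lt with h | h
  · congr 2
    ext s
    simp only [← h, Set.mem_inter_iff, Set.mem_Ioi, Set.mem_Icc, Set.mem_Ioc]
    exact ⟨fun hh => ⟨hh.1, hh.2.2⟩, fun hh => ⟨hh.1, hh.1.le, hh.2⟩⟩
  · rw [← integral_Icc_eq_integral_Ioc]
    congr 2
    refine Set.inter_eq_right.2 fun s hs => ?_
    exact lt_of_lt_of_le h hs.1

/-- Falconer's annulus Fourier estimate:
`|χ̂(ξ)| ≤ C · r^{1/2} · |ξ|^{-1/2} · min(r^δ, |ξ|⁻¹)` with an absolute constant. -/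
theorem stmt10 :
    ∃ C > (0 : ℝ), ∀ (r δ : ℝ), 0 < r → r < 1 → 1 ≤ δ →
      ∀ ξ : EuclideanSpace ℝ (Fin 2), ξ ≠ 0 →
        ‖ft (annInd r δ) ξ‖ ≤
          C * Real.sqrt r * ‖ξ‖ ^ (-(1 : ℝ) / 2) * min (r ^ δ) ‖ξ‖⁻¹ := by
  refine ⟨48, by norm_num, ?_⟩
  intro r δ hr hr1 hδ ξ hξ
  have hρ : 0 < ‖ξ‖ := norm_pos_iff.2 hξ
  have hrd : 0 < r ^ δ := Real.rpow_pos_of_pos hr δ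
  have hle : r ^ δ ≤ r := by
    have := Real.rpow_le_rpow_of_exponent_ge hr hr1.le hδ
    rwa [Real.rpow_one] at this
  rw [ft_eq r δ (by linarith) (by linarith)]
  have hk : ‖ξ‖ ≤ 2 * π * ‖ξ‖ := by nlinarith [Real.pi_gt_three]
  refine (radial_bound (2 * π * ‖ξ‖) (r - r ^ δ) r (by positivity) (by linarith)
    (by linarith)).trans ?_
  rw [sub_sub_cancel]
  have e : ‖ξ‖ ^ (-(1 : ℝ) / 2) = (√‖ξ‖)⁻¹ := by
    rw [Real.sqrt_eq_rpow, ← Real.rpow_neg hρ.le]; norm_num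
  rw [e, ← div_eq_mul_inv]
  have hs : 0 < √‖ξ‖ := Real.sqrt_pos.2 hρ
  gcongr
end

section
/- Let μ be a compactly supported t-regular measure on ℝ² with 1/2 < t ≤ 2, let s = (t + 1/2)/2 and δ = 4. Then ∫_{ℝ²} μ(A(x,r,4)) dμ(x) ≤ C · r^{1/2 + 4(s−1/2)} · I_s(μ) = C · r^{t+1/2} · I_s(μ), where I_s(μ) is the s-energy of μ and C is an absolute constant. -/
open MeasureTheory Metric Set Filter
open scoped ENNReal

/-- The annulus `A(x,r,4) = B(x,r) \ B(x, r - r^4)` in the Euclidean plane. -/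
noncomputable def ann4 (x : EuclideanSpace ℝ (Fin 2)) (r : ℝ) :
    Set (EuclideanSpace ℝ (Fin 2)) :=
  closedBall x r \ closedBall x (r - r ^ (4 : ℕ))

/-- The `s`-energy `I_s(μ) = ∬ ‖x-y‖^{-s} dμ(x) dμ(y)`. -/
noncomputable def energy (μ : Measure (EuclideanSpace ℝ (Fin 2))) (s : ℝ) : ℝ≥0∞ :=
  ∫⁻ x, ∫⁻ y, ENNReal.ofReal (‖x - y‖ ^ (-s)) ∂μ ∂μ

abbrev E2 := EuclideanSpace ℝ (Fin 2)

theorem nsq (a b : E2) : ‖a - b‖ ^ 2 = (a 0 - b 0) ^ 2 + (a 1 - b 1) ^ 2 := by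
  rw [EuclideanSpace.norm_sq_eq]; simp [Fin.sum_univ_two]

theorem sgn_sq {σ p q r t : ℝ} (hσ : σ ^ 2 = 1) (hp : 0 ≤ σ * p) (hq : 0 ≤ σ * q)
    (hr : 0 ≤ σ * r) (ht : 0 ≤ σ * t) : p ^ 2 ≤ (p + q + r + t) ^ 2 := by
  have h1 : p ^ 2 = (σ * p) ^ 2 := by rw [mul_pow, hσ, one_mul]
  have h2 : (p + q + r + t) ^ 2 = (σ * p + σ * q + σ * r + σ * t) ^ 2 := by
    have : σ * p + σ * q + σ * r + σ * t = σ * (p + q + r + t) := by ring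
    rw [this, mul_pow, hσ, one_mul]
  rw [h1, h2]
  exact pow_le_pow_left₀ hp (by linarith) 2

/-- Transversality in the plane. -/
theorem plane_transversal (r e0 e1 u0 u1 v0 v1 : ℝ) (hr : 0 < r) (hr2 : r ≤ 1 / 2)
    (he : 64 * r ^ 6 ≤ e0 ^ 2 + e1 ^ 2) (he' : e0 ^ 2 + e1 ^ 2 ≤ 4 * r ^ 2)
    (hu : 3 / 4 * r ^ 2 ≤ u0 ^ 2 + u1 ^ 2)
    (hue : (u0 * e0 + u1 * e1) ^ 2 ≤ 16 * r ^ 10)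
    (hve : (v0 * e0 + v1 * e1) ^ 2 ≤ 4 * r ^ 10)
    (hvu : (v0 * u0 + v1 * u1) ^ 2 ≤ 16 * r ^ 10) :
    (v0 ^ 2 + v1 ^ 2) * (e0 ^ 2 + e1 ^ 2) ≤ 256 * r ^ 8 := by
  set A := e0 ^ 2 + e1 ^ 2 with hA
  set B := u0 ^ 2 + u1 ^ 2 with hB
  set V := v0 ^ 2 + v1 ^ 2 with hV
  have hr10 : r ^ 10 ≤ r ^ 8 / 4 := by
    have : r ^ 10 = r ^ 8 * r ^ 2 := by ring
    have h2 : r ^ 2 ≤ 1 / 4 := by nlinarith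
    rw [this]; nlinarith [pow_pos hr 8]
  have hB0 : 0 < B := lt_of_lt_of_le (by positivity) hu
  have hAB : 48 * r ^ 8 ≤ A * B := by
    have := mul_le_mul he hu (by positivity) (by positivity)
    calc 48 * r ^ 8 = 64 * r ^ 6 * (3 / 4 * r ^ 2) := by ring
      _ ≤ _ := this
  have hw : (e0 * u1 - e1 * u0) ^ 2 = A * B - (u0 * e0 + u1 * e1) ^ 2 := by
    rw [hA, hB]; ring
  have hw2 : A * B / 4 ≤ (e0 * u1 - e1 * u0) ^ 2 := by
    rw [hw]; nlinarith [pow_pos hr 8]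
  have hid : V * (e0 * u1 - e1 * u0) ^ 2 =
      ((v0 * e0 + v1 * e1) * u0 - (v0 * u0 + v1 * u1) * e0) ^ 2 +
      ((v0 * e0 + v1 * e1) * u1 - (v0 * u0 + v1 * u1) * e1) ^ 2 := by rw [hV]; ring
  set p := v0 * e0 + v1 * e1
  set q := v0 * u0 + v1 * u1
  have hle : V * (e0 * u1 - e1 * u0) ^ 2 ≤ 2 * (p ^ 2 * B + q ^ 2 * A) := by
    rw [hid, hA, hB]
    nlinarith [sq_nonneg (p * u0 + q * e0), sq_nonneg (p * u1 + q * e1)]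
  have hV0 : 0 ≤ V := by rw [hV]; positivity
  have hA0 : 0 ≤ A := by rw [hA]; positivity
  have h1 : V * (A * B / 4) ≤ 2 * (4 * r ^ 10 * B + 16 * r ^ 10 * A) := by
    calc V * (A * B / 4) ≤ V * (e0 * u1 - e1 * u0) ^ 2 := by gcongr
      _ ≤ _ := hle
      _ ≤ _ := by gcongr
  have hAB2 : A ≤ 16 / 3 * B := by linarith
  have h2 : V * (A * B / 4) ≤ 2 * (4 * r ^ 10 * B + 16 * r ^ 10 * (16 / 3 * B)) := by
    refine h1.trans ?_
    gcongr
  have h3 : (V * A) * B ≤ (8 * (4 + 256 / 3) * r ^ 10) * B := by nlinarith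
  have h4 := le_of_mul_le_mul_right h3 hB0
  nlinarith [pow_pos hr 8]

/-- The pairs `(x,y)` at distance about `r`, with `x - y` in a given quadrant. -/
def quadPairs (r σ τ : ℝ) : Set (E2 × E2) :=
  {p | ‖p.1 - p.2‖ ≤ r ∧ r - r ^ 4 < ‖p.1 - p.2‖ ∧
    0 ≤ σ * (p.1 0 - p.2 0) ∧ 0 ≤ τ * (p.1 1 - p.2 1)}

theorem quadPairs_meas (r σ τ : ℝ) : MeasurableSet (quadPairs r σ τ) := by
  have h1 : Continuous fun p : E2 × E2 => ‖p.1 - p.2‖ := by fun_prop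
  have h2 : Continuous fun p : E2 × E2 => σ * (p.1 0 - p.2 0) := by fun_prop
  have h3 : Continuous fun p : E2 × E2 => τ * (p.1 1 - p.2 1) := by fun_prop
  exact (measurableSet_le h1.measurable measurable_const).inter
    ((measurableSet_lt measurable_const h1.measurable).inter
      ((measurableSet_le measurable_const h2.measurable).inter
        (measurableSet_le measurable_const h3.measurable)))

theorem quad_sq {r σ τ : ℝ} {x y : E2} (hr : 0 < r) (hr2 : r ≤ 1 / 2)
    (h : (x, y) ∈ quadPairs r σ τ) :
    r ^ 2 - 2 * r ^ 5 ≤ (x 0 - y 0) ^ 2 + (x 1 - y 1) ^ 2 ∧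
    (x 0 - y 0) ^ 2 + (x 1 - y 1) ^ 2 ≤ r ^ 2 := by
  obtain ⟨h1, h2, -, -⟩ := h
  simp only at h1 h2
  have hr3 : r ^ 3 ≤ 1 / 8 := by
    calc r ^ 3 ≤ (1 / 2) ^ 3 := by gcongr
      _ = _ := by norm_num
  have h0 : 0 ≤ r - r ^ 4 := by nlinarith [pow_pos hr 3]
  rw [← nsq]
  constructor
  · have := pow_le_pow_left₀ h0 h2.le 2
    nlinarith [pow_pos hr 8]
  · exact pow_le_pow_left₀ (norm_nonneg _) h1 2

theorem geo {r σ τ : ℝ} (hr : 0 < r) (hr2 : r ≤ 1 / 2) (hσ : σ ^ 2 = 1) (hτ : τ ^ 2 = 1)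
    {x x' y z : E2} (hxy : (x, y) ∈ quadPairs r σ τ) (hxy' : (x', y) ∈ quadPairs r σ τ)
    (hxz : (x, z) ∈ quadPairs r σ τ) (hxz' : (x', z) ∈ quadPairs r σ τ) :
    ‖y - z‖ * ‖x - x'‖ ≤ 16 * r ^ 4 := by
  obtain ⟨a1, a2⟩ := quad_sq hr hr2 hxy
  obtain ⟨b1, b2⟩ := quad_sq hr hr2 hxy'
  obtain ⟨c1, c2⟩ := quad_sq hr hr2 hxz
  obtain ⟨d1, d2⟩ := quad_sq hr hr2 hxz'
  have hv : ‖y - z‖ ≤ 2 * r := by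
    have : y - z = (x - z) - (x - y) := by abel
    rw [this]
    have := norm_sub_le (x - z) (x - y)
    have e1 := hxy.1
    have e2 := hxz.1
    simp only at e1 e2
    linarith
  have he : ‖x - x'‖ ≤ 2 * r := by
    have : x - x' = (x - z) - (x' - z) := by abel
    rw [this]
    have := norm_sub_le (x - z) (x' - z)
    have e1 := hxz'.1
    have e2 := hxz.1
    simp only at e1 e2
    linarith
  rcases le_total (‖x - x'‖) (8 * r ^ 3) with hd | hd
  · calc ‖y - z‖ * ‖x - x'‖ ≤ (2 * r) * (8 * r ^ 3) := by gcongr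
      _ = _ := by ring
  · refine (pow_le_pow_iff_left₀ (by positivity) (by positivity) (two_ne_zero)).1 ?_
    rw [mul_pow, nsq, nsq]
    have h5 : 0 < r ^ 5 := by positivity
    have hr3 : r ^ 3 ≤ 1 / 8 := by
      calc r ^ 3 ≤ (1 / 2) ^ 3 := by gcongr
        _ = _ := by norm_num
    have key := plane_transversal r (x 0 - x' 0) (x 1 - x' 1)
      ((x 0 - y 0) + (x' 0 - y 0) + (x 0 - z 0) + (x' 0 - z 0))
      ((x 1 - y 1) + (x' 1 - y 1) + (x 1 - z 1) + (x' 1 - z 1))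
      (y 0 - z 0) (y 1 - z 1) hr hr2 ?_ ?_ ?_ ?_ ?_ ?_
    · exact key.trans (le_of_eq (by ring))
    · rw [← nsq]
      calc 64 * r ^ 6 = (8 * r ^ 3) ^ 2 := by ring
        _ ≤ _ := by gcongr
    · rw [← nsq]
      calc ‖x - x'‖ ^ 2 ≤ (2 * r) ^ 2 := by gcongr
        _ = _ := by ring
    · have s0 := sgn_sq hσ hxy.2.2.1 hxy'.2.2.1 hxz.2.2.1 hxz'.2.2.1
      have s1 := sgn_sq hτ hxy.2.2.2 hxy'.2.2.2 hxz.2.2.2 hxz'.2.2.2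
      simp only at s0 s1
      have : r ^ 5 = r ^ 2 * r ^ 3 := by ring
      nlinarith [pow_pos hr 2]
    · calc _ ≤ (4 * r ^ 5) ^ 2 := by
            apply sq_le_sq'
            · nlinarith
            · nlinarith
        _ = _ := by ring
    · calc _ ≤ (2 * r ^ 5) ^ 2 := by
            apply sq_le_sq'
            · nlinarith
            · nlinarith
        _ = _ := by ring
    · calc _ ≤ (4 * r ^ 5) ^ 2 := by
            apply sq_le_sq'
            · nlinarith
            · nlinarith
        _ = _ := by ring

/-- The `s`-potential. -/
noncomputable def pot (μ : Measure E2) (s : ℝ) (y : E2) : ℝ≥0∞ :=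
  ∫⁻ x, ENNReal.ofReal (‖y - x‖ ^ (-s)) ∂μ

theorem ker_meas (s : ℝ) : Measurable fun p : E2 × E2 => ENNReal.ofReal (‖p.1 - p.2‖ ^ (-s)) := by
  fun_prop

theorem pot_meas (μ : Measure E2) [IsFiniteMeasure μ] (s : ℝ) : Measurable (pot μ s) :=
  (ker_meas s).lintegral_prod_right'

/-- `μ / pot μ s` is automatically `s`-Frostman. -/
theorem frostman (μ : Measure E2) [IsFiniteMeasure μ] [NullSingletonClass μ] (s : ℝ) (hs : 0 ≤ s)
    (B : Set E2) (hB : MeasurableSet B) (D : ℝ) (hD : 0 < D)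
    (h : ∀ y ∈ B, ∀ z ∈ B, ‖y - z‖ ≤ D) :
    ∫⁻ y in B, (pot μ s y)⁻¹ ∂μ ≤ ENNReal.ofReal (D ^ s) := by
  have hDs : 0 < D ^ s := Real.rpow_pos_of_pos hD s
  have h1 : ∀ y ∈ B, ENNReal.ofReal (D ^ (-s)) * μ B ≤ pot μ s y := by
    intro y hy
    have : ∀ᵐ z ∂μ, z ≠ y := by
      rw [ae_iff]; simp
    calc ENNReal.ofReal (D ^ (-s)) * μ B
        = ∫⁻ z in B, ENNReal.ofReal (D ^ (-s)) ∂μ := by simp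
      _ ≤ ∫⁻ z in B, ENNReal.ofReal (‖y - z‖ ^ (-s)) ∂μ := by
          apply lintegral_mono_ae
          filter_upwards [ae_restrict_mem hB, ae_restrict_of_ae this] with z hz hzy
          apply ENNReal.ofReal_le_ofReal
          apply Real.rpow_le_rpow_of_nonpos _ (h y hy z hz) (by linarith)
          exact norm_pos_iff.2 (sub_ne_zero.2 (Ne.symm hzy))
      _ ≤ _ := setLIntegral_le_lintegral _ _
  calc ∫⁻ y in B, (pot μ s y)⁻¹ ∂μ
      ≤ ∫⁻ y in B, (ENNReal.ofReal (D ^ (-s)) * μ B)⁻¹ ∂μ := by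
        apply setLIntegral_mono' hB
        intro y hy
        exact ENNReal.inv_le_inv.2 (h1 y hy)
    _ = (ENNReal.ofReal (D ^ (-s)))⁻¹ * ((μ B)⁻¹ * μ B) := by
        rw [setLIntegral_const, ENNReal.mul_inv, mul_assoc]
        · right; exact measure_ne_top _ _
        · left; exact ENNReal.ofReal_ne_top
    _ ≤ (ENNReal.ofReal (D ^ (-s)))⁻¹ * 1 := by
        gcongr
        exact ENNReal.inv_mul_le_one _
    _ = _ := by
        rw [mul_one, Real.rpow_neg hD.le, ENNReal.ofReal_inv_of_pos hDs, inv_inv]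

theorem amgm (a f U : ℝ≥0∞) (ha : a ≠ 0) (ha' : a ≠ ∞) (hf : f ≠ ∞) :
    f ≤ a * U + a⁻¹ * (f * f * U⁻¹) := by
  rcases le_total f (a * U) with h | h
  · exact h.trans le_self_add
  · refine le_trans ?_ le_add_self
    rcases eq_or_ne f 0 with rfl | h0
    · simp
    have : f⁻¹ ≤ a⁻¹ * U⁻¹ := by
      rw [← ENNReal.mul_inv (Or.inl ha) (Or.inl ha')]
      exact ENNReal.inv_le_inv.2 h
    calc f = f * f * f⁻¹ := by rw [mul_assoc, ENNReal.mul_inv_cancel h0 hf, mul_one]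
      _ ≤ f * f * (a⁻¹ * U⁻¹) := by gcongr
      _ = _ := by ring

theorem quad_bound (μ : Measure E2) [IsFiniteMeasure μ] [NullSingletonClass μ] (s : ℝ) (hs : 0 ≤ s)
    (hs2 : s ≤ 5 / 4) {r σ τ : ℝ} (hr : 0 < r) (hr2 : r ≤ 1 / 2) (hσ : σ ^ 2 = 1)
    (hτ : τ ^ 2 = 1) :
    ∫⁻ y, μ {x | (x, y) ∈ quadPairs r σ τ} ∂μ ≤ ENNReal.ofReal (33 * r ^ (2 * s)) * energy μ s := by
  set T := quadPairs r σ τ with hT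
  have hTm : MeasurableSet T := quadPairs_meas r σ τ
  set f : E2 → ℝ≥0∞ := fun y => μ {x | (x, y) ∈ T} with hf
  set U := pot μ s with hU
  have hUm : Measurable U := pot_meas μ s
  have ha0 : 0 < r ^ (2 * s) := Real.rpow_pos_of_pos hr _
  set a := ENNReal.ofReal (r ^ (2 * s)) with ha
  have hfm : Measurable f := measurable_measure_prodMk_right hTm
  have hmeas3 : MeasurableSet {q : E2 × (E2 × E2) | (q.2.1, q.1) ∈ T ∧ (q.2.2, q.1) ∈ T} := by
    apply MeasurableSet.inter
    · exact hTm.preimage (f := fun q : E2 × (E2 × E2) => (q.2.1, q.1)) (by fun_prop)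
    · exact hTm.preimage (f := fun q : E2 × (E2 × E2) => (q.2.2, q.1)) (by fun_prop)
  set W := {q : E2 × (E2 × E2) | (q.2.1, q.1) ∈ T ∧ (q.2.2, q.1) ∈ T} with hW
  set F : E2 → E2 × E2 → ℝ≥0∞ := fun y p => W.indicator (fun q => (U q.1)⁻¹) (y, p) with hF
  have hFm : Measurable (Function.uncurry F) := by
    have : Function.uncurry F = W.indicator (fun q => (U q.1)⁻¹) := by
      ext ⟨y, p⟩; rfl
    rw [this]
    exact (hUm.comp measurable_fst).inv.indicator hmeas3
  have e1 : ∀ y, f y * f y * (U y)⁻¹ = ∫⁻ p, F y p ∂(μ.prod μ) := by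
    intro y
    have hS : MeasurableSet {x | (x, y) ∈ T} := hTm.preimage (f := fun x => (x, y)) (by fun_prop)
    have : (fun p => F y p) =
        ({x | (x, y) ∈ T} ×ˢ {x | (x, y) ∈ T}).indicator (fun _ => (U y)⁻¹) := by
      ext p
      by_cases h : (y, p) ∈ W
      · have h2 : p ∈ {x | (x, y) ∈ T} ×ˢ {x | (x, y) ∈ T} := h
        simp only [hF, indicator_of_mem h, indicator_of_mem h2]
      · have h2 : p ∉ {x | (x, y) ∈ T} ×ˢ {x | (x, y) ∈ T} := h
        simp only [hF, indicator_of_notMem h, indicator_of_notMem h2]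
    rw [this, lintegral_indicator_const (hS.prod hS), Measure.prod_prod, mul_comm]
  have e2 : ∫⁻ y, f y * f y * (U y)⁻¹ ∂μ ≤ ENNReal.ofReal (32 * r ^ (4 * s)) * energy μ s := by
    simp_rw [e1]
    rw [lintegral_lintegral_swap hFm.aemeasurable]
    have hm2 : Measurable fun p => ∫⁻ y, F y p ∂μ := hFm.lintegral_prod_left'
    rw [lintegral_prod _ hm2.aemeasurable, energy, ← lintegral_const_mul' _ _ ENNReal.ofReal_ne_top]
    apply lintegral_mono
    intro x
    simp only
    rw [← lintegral_const_mul' _ _ ENNReal.ofReal_ne_top]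
    apply lintegral_mono_ae
    have : ∀ᵐ z ∂μ, z ≠ x := by
      rw [ae_iff]; simp
    filter_upwards [this] with x' hx'
    have hd : 0 < ‖x - x'‖ := norm_pos_iff.2 (sub_ne_zero.2 (Ne.symm hx'))
    have hBm : MeasurableSet {y | (x, y) ∈ T ∧ (x', y) ∈ T} :=
      (hTm.preimage (f := fun y => (x, y)) (by fun_prop)).inter
        (hTm.preimage (f := fun y => (x', y)) (by fun_prop))
    have hFi : (fun y => F y (x, x')) =
        ({y | (x, y) ∈ T ∧ (x', y) ∈ T}).indicator (fun y => (U y)⁻¹) := by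
      ext y
      by_cases h : (y, (x, x')) ∈ W
      · have h2 : y ∈ {y | (x, y) ∈ T ∧ (x', y) ∈ T} := h
        simp only [hF, indicator_of_mem h, indicator_of_mem h2]
      · have h2 : y ∉ {y | (x, y) ∈ T ∧ (x', y) ∈ T} := h
        simp only [hF, indicator_of_notMem h, indicator_of_notMem h2]
    rw [hFi, lintegral_indicator hBm]
    refine (frostman μ s hs _ hBm (16 * r ^ 4 / ‖x - x'‖) (by positivity) ?_).trans ?_
    · rintro y ⟨hy, hy'⟩ z ⟨hz, hz'⟩
      rw [le_div_iff₀ hd]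
      exact geo hr hr2 hσ hτ hy hy' hz hz'
    · rw [← ENNReal.ofReal_mul (by positivity)]
      apply ENNReal.ofReal_le_ofReal
      rw [Real.div_rpow (by positivity) hd.le, Real.mul_rpow (by positivity) (by positivity),
        ← Real.rpow_natCast, ← Real.rpow_mul hr.le, Real.rpow_neg hd.le, div_eq_mul_inv]
      push_cast
      have : (16 : ℝ) ^ s ≤ 32 := by
        calc (16 : ℝ) ^ s ≤ 16 ^ (5 / 4 : ℝ) := Real.rpow_le_rpow_of_exponent_le (by norm_num) hs2
          _ = ((2 : ℝ) ^ (4 : ℝ)) ^ (5 / 4 : ℝ) := by norm_num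
          _ = 2 ^ (5 : ℝ) := by rw [← Real.rpow_mul (by norm_num)]; norm_num
          _ = 32 := by norm_num
      gcongr
  have e3 : ∀ y, f y ≤ a * U y + a⁻¹ * (f y * f y * (U y)⁻¹) := fun y =>
    amgm a (f y) (U y) (by simpa [ha] using ha0) ENNReal.ofReal_ne_top (measure_ne_top _ _)
  have ha1 : a⁻¹ ≠ ∞ := by simpa [ha] using ha0
  calc ∫⁻ y, f y ∂μ ≤ ∫⁻ y, (a * U y + a⁻¹ * (f y * f y * (U y)⁻¹)) ∂μ := lintegral_mono e3
    _ = a * ∫⁻ y, U y ∂μ + a⁻¹ * ∫⁻ y, f y * f y * (U y)⁻¹ ∂μ := by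
        rw [lintegral_add_left (hUm.const_mul a), lintegral_const_mul' _ _ ENNReal.ofReal_ne_top,
          lintegral_const_mul' _ _ ha1]
    _ ≤ a * energy μ s + a⁻¹ * (ENNReal.ofReal (32 * r ^ (4 * s)) * energy μ s) := by
        gcongr
        exact le_rfl
    _ = (a + a⁻¹ * ENNReal.ofReal (32 * r ^ (4 * s))) * energy μ s := by ring
    _ = _ := by
        congr 1
        rw [ha, ← ENNReal.ofReal_inv_of_pos ha0, ← ENNReal.ofReal_mul (by positivity),
          ← ENNReal.ofReal_add (by positivity) (by positivity)]
        congr 1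
        have : r ^ (4 * s) = r ^ (2 * s) * r ^ (2 * s) := by
          rw [← Real.rpow_add hr]; ring_nf
        rw [this]
        field_simp
        norm_num

theorem no_atoms_of (μ : Measure E2) (t : ℝ) (ht : 0 < t) (K : Set E2)
    (hμ : μ Kᶜ = 0) (Ct : ℝ) (hK : 0 < Metric.diam K)
    (h : ∀ x ∈ K, ∀ r : ℝ, 0 < r → r < Metric.diam K →
      μ (closedBall x r) ≤ ENNReal.ofReal (Ct * r ^ t)) : NullSingletonClass μ := by
  constructor
  intro x
  by_cases hx : x ∈ K
  · have hlim : Tendsto (fun ρ : ℝ => ENNReal.ofReal (Ct * ρ ^ t)) (nhdsWithin 0 (Ioi 0))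
        (nhds 0) := by
      have hc : Continuous fun ρ : ℝ => ENNReal.ofReal (Ct * ρ ^ t) := by
        have h0 := Real.continuous_rpow_const ht.le
        exact ENNReal.continuous_ofReal.comp (h0.const_mul Ct)
      have := hc.tendsto 0
      rw [Real.zero_rpow ht.ne', mul_zero, ENNReal.ofReal_zero] at this
      exact this.mono_left nhdsWithin_le_nhds
    refine le_antisymm (ge_of_tendsto hlim ?_) zero_le
    filter_upwards [Ioo_mem_nhdsGT hK] with ρ hρ
    refine le_trans (measure_mono ?_) (h x hx ρ hρ.1 hρ.2)
    simpa using hρ.1.le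
  · exact measure_mono_null (by simpa using hx) hμ

/-- Energy bound on the average measure of thin annuli: with `s = (t+1/2)/2`
and `δ = 4`, `∫ μ(A(x,r,4)) dμ(x) ≤ C · r^{t+1/2} · I_s(μ)` for an absolute
constant `C`. -/
theorem stmt12 :
    ∃ C > (0 : ℝ), ∀ (μ : Measure (EuclideanSpace ℝ (Fin 2))), IsFiniteMeasure μ →
      ∀ t : ℝ, 1 / 2 < t → t ≤ 2 →
      ∀ K : Set (EuclideanSpace ℝ (Fin 2)), IsCompact K → μ Kᶜ = 0 →
      ∀ c Ct : ℝ, 0 < c → 0 < Ct →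
      (∀ x ∈ K, ∀ r : ℝ, 0 < r → r < Metric.diam K →
        ENNReal.ofReal (c * r ^ t) ≤ μ (closedBall x r) ∧
        μ (closedBall x r) ≤ ENNReal.ofReal (Ct * r ^ t)) →
      ∀ r : ℝ, 0 < r → r < 1 →
        ∫⁻ x, μ (ann4 x r) ∂μ ≤
          ENNReal.ofReal (C * r ^ (t + 1 / 2)) * energy μ ((t + 1 / 2) / 2) := by
  refine ⟨132, by norm_num, ?_⟩
  intro μ hfin t ht1 ht2 K hK hμK c Ct hc hCt hreg r hr hr1
  have hr4 : r ^ 4 < r := by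
    have := pow_lt_one₀ hr.le hr1 (three_ne_zero)
    calc r ^ 4 = r ^ 3 * r := by ring
      _ < 1 * r := by gcongr
      _ = r := one_mul r
  have hann : ∀ x y : E2, y ∈ ann4 x r ↔ ‖x - y‖ ≤ r ∧ r - r ^ 4 < ‖x - y‖ := by
    intro x y
    simp only [ann4, Set.mem_sdiff, mem_closedBall, dist_eq_norm, not_le, norm_sub_rev y x]
  rcases (Metric.diam_nonneg (s := K)).eq_or_lt with hd | hd
  · have : ∫⁻ x, μ (ann4 x r) ∂μ = 0 := by
      have hae : ∀ᵐ x ∂μ, x ∈ K := hμK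
      rw [lintegral_congr_ae (g := fun _ => 0)]
      · simp
      filter_upwards [hae] with x hx
      refine measure_mono_null ?_ hμK
      intro y hy hyK
      have h1 := Metric.dist_le_diam_of_mem hK.isBounded hx hyK
      rw [← hd, dist_eq_norm] at h1
      have := ((hann x y).1 hy).2
      linarith
    rw [this]; exact zero_le
  have := no_atoms_of μ t (by linarith) K hμK Ct hd (fun x hx ρ h1 h2 => (hreg x hx ρ h1 h2).2)
  set s := (t + 1 / 2) / 2 with hs
  have hts : t + 1 / 2 = 2 * s := by rw [hs]; ring
  rw [hts]
  have hs0 : 0 < s := by rw [hs]; linarith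
  have hs2 : s ≤ 5 / 4 := by rw [hs]; linarith
  rcases le_total r (1 / 2) with hr2 | hr2
  · have hsub : ∀ y, μ (ann4 y r) ≤ μ {x | (x, y) ∈ quadPairs r 1 1} +
        μ {x | (x, y) ∈ quadPairs r 1 (-1)} + μ {x | (x, y) ∈ quadPairs r (-1) 1} +
        μ {x | (x, y) ∈ quadPairs r (-1) (-1)} := by
      intro y
      refine le_trans (measure_mono (t := (({x | (x, y) ∈ quadPairs r 1 1} ∪
        {x | (x, y) ∈ quadPairs r 1 (-1)}) ∪ {x | (x, y) ∈ quadPairs r (-1) 1}) ∪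
        {x | (x, y) ∈ quadPairs r (-1) (-1)}) ?_) ?_
      · intro x hx
        rw [hann, norm_sub_rev] at hx
        obtain ⟨h1, h2⟩ := hx
        simp only [mem_union, mem_ofPred_eq, quadPairs, h1, h2, true_and]
        rcases le_total 0 (x 0 - y 0) with h3 | h3 <;> rcases le_total 0 (x 1 - y 1) with h4 | h4
        · left; left; left; constructor <;> linarith
        · left; left; right; constructor <;> linarith
        · left; right; constructor <;> linarith
        · right; constructor <;> linarith
      · refine (measure_union_le _ _).trans ?_
        gcongr
        refine (measure_union_le _ _).trans ?_
        gcongr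
        exact measure_union_le _ _
    have hm : ∀ σ τ : ℝ, Measurable fun y => μ {x | (x, y) ∈ quadPairs r σ τ} := fun σ τ =>
      measurable_measure_prodMk_right (quadPairs_meas r σ τ)
    have hq : ∀ σ τ : ℝ, σ ^ 2 = 1 → τ ^ 2 = 1 → _ := fun σ τ hσ hτ =>
      quad_bound μ s hs0.le hs2 hr hr2 hσ hτ
    calc ∫⁻ y, μ (ann4 y r) ∂μ ≤ _ := lintegral_mono hsub
      _ = _ := by
        rw [lintegral_add_right _ (hm _ _), lintegral_add_right _ (hm _ _),
          lintegral_add_right _ (hm _ _)]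
      _ ≤ _ := add_le_add (add_le_add (add_le_add (hq 1 1 (by norm_num) (by norm_num))
          (hq 1 (-1) (by norm_num) (by norm_num))) (hq (-1) 1 (by norm_num) (by norm_num)))
          (hq (-1) (-1) (by norm_num) (by norm_num))
      _ = 4 * ENNReal.ofReal (33 * r ^ (2 * s)) * energy μ s := by ring
      _ = _ := by
        congr 1
        rw [show (132 : ℝ) * r ^ (2 * s) = 4 * (33 * r ^ (2 * s)) by ring,
          ENNReal.ofReal_mul (by norm_num : (0 : ℝ) ≤ 4)]
        norm_num
  · rw [energy, ← lintegral_const_mul' _ _ ENNReal.ofReal_ne_top]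
    apply lintegral_mono
    intro x
    simp only
    rw [← lintegral_const_mul' _ _ ENNReal.ofReal_ne_top]
    have hAm : MeasurableSet (ann4 x r) := measurableSet_closedBall.diff measurableSet_closedBall
    rw [← lintegral_indicator_one hAm]
    apply lintegral_mono
    intro y
    by_cases hy : y ∈ ann4 x r
    · simp only
      rw [indicator_of_mem hy, ← ENNReal.ofReal_mul (by positivity), Pi.one_apply,
        ← ENNReal.ofReal_one]
      apply ENNReal.ofReal_le_ofReal
      obtain ⟨h1, h2⟩ := (hann x y).1 hy
      have hd0 : 0 < ‖x - y‖ := by linarith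
      have h3 : r ^ (-s) ≤ ‖x - y‖ ^ (-s) := Real.rpow_le_rpow_of_nonpos hd0 h1 (by linarith)
      have h4 : (1 / 2 : ℝ) ^ (5 / 4 : ℝ) ≤ r ^ s :=
        calc (1 / 2 : ℝ) ^ (5 / 4 : ℝ) ≤ (1 / 2) ^ s :=
              Real.rpow_le_rpow_of_exponent_ge (by norm_num) (by norm_num) hs2
          _ ≤ r ^ s := by gcongr
      have h5 : (1 / 2 : ℝ) ^ (2 : ℝ) ≤ (1 / 2 : ℝ) ^ (5 / 4 : ℝ) :=
        Real.rpow_le_rpow_of_exponent_ge (by norm_num) (by norm_num) (by norm_num)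
      have h6 : (1 / 2 : ℝ) ^ (2 : ℝ) = 1 / 4 := by norm_num
      calc (1 : ℝ) ≤ 132 * r ^ s := by linarith
        _ = 132 * (r ^ (2 * s) * r ^ (-s)) := by
            rw [← Real.rpow_add hr]; ring_nf
        _ = 132 * r ^ (2 * s) * r ^ (-s) := by ring
        _ ≤ _ := by gcongr
    · rw [indicator_of_notMem hy]; exact zero_le
end
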